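/- Suppose the density of states of a one-cut matrix model on $\sigma = [-2,2]$ is $\rho(\lambda) = \frac{1}{2\pi}\lambda^2 P_0(\lambda)\sqrt{4-\lambda^2}$ and satisfies the equilibrium equation $V'(\lambda) = 2\,\mathrm{p.v.}\int_{-2}^2 \frac{\rho(\mu)}{\lambda-\mu}\,d\mu$ for $\lambda \in [-2,2]$. Define $Q(\lambda) = \int_{-2}^{2} \frac{V'(\lambda)-V'(\mu)}{\lambda-\mu}\rho(\mu)\,d\mu$. Then for all $\lambda \in [-2,2]$: $Q(\lambda) = \frac{1}{4}\left([V'(\lambda)]^2 + \lambda^4 P_0^2(\lambda)(4-\lambda^2)\right)$. -/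

import Mathlib

open MeasureTheory Filter Topology

/-- The conjugate Poisson kernel, without its normalising factor. -/
noncomputable def conjPoissonKer (ε t : ℝ) : ℝ := t / (t ^ 2 + ε ^ 2)

/-- The Poisson kernel of the half-plane, without its normalising factor. -/
noncomputable def poissonKer (ε t : ℝ) : ℝ := ε / (t ^ 2 + ε ^ 2)

lemma conjPoissonKer_neg (ε t : ℝ) : conjPoissonKer ε (-t) = -conjPoissonKer ε t := by
  simp [conjPoissonKer, neg_div]

lemma conjPoissonKer_sub_comm (ε a b : ℝ) :
    conjPoissonKer ε (a - b) = -conjPoissonKer ε (b - a) := by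
  rw [← conjPoissonKer_neg, neg_sub]

lemma poissonKer_sub_comm (ε a b : ℝ) : poissonKer ε (a - b) = poissonKer ε (b - a) := by
  simp only [poissonKer, sub_sq_comm]

lemma continuous_conjPoissonKer {ε : ℝ} (hε : 0 < ε) : Continuous (conjPoissonKer ε) := by
  unfold conjPoissonKer
  exact continuous_id.div (by fun_prop) fun t => by positivity

lemma continuous_poissonKer {ε : ℝ} (hε : 0 < ε) : Continuous (poissonKer ε) := by
  unfold poissonKer
  exact continuous_const.div (by fun_prop) fun t => by positivity

lemma poissonKer_nonneg {ε : ℝ} (hε : 0 < ε) (t : ℝ) : 0 ≤ poissonKer ε t := by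
  unfold poissonKer; positivity

lemma poissonKer_le {ε : ℝ} (hε : 0 < ε) (t : ℝ) : poissonKer ε t ≤ ε⁻¹ := by
  unfold poissonKer
  rw [div_le_iff₀ (by positivity)]
  field_simp
  nlinarith [sq_nonneg t]

lemma abs_poissonKer_le {ε : ℝ} (hε : 0 < ε) (t : ℝ) : |poissonKer ε t| ≤ ε⁻¹ := by
  rw [abs_of_nonneg (poissonKer_nonneg hε t)]
  exact poissonKer_le hε t

lemma abs_conjPoissonKer_le {ε : ℝ} (hε : 0 < ε) (t : ℝ) : |conjPoissonKer ε t| ≤ ε⁻¹ := by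
  unfold conjPoissonKer
  rw [abs_div, abs_of_pos (by positivity : 0 < t ^ 2 + ε ^ 2), div_le_iff₀ (by positivity)]
  field_simp
  nlinarith [sq_abs t, sq_nonneg (|t| - ε), sq_nonneg (|t| + ε)]

lemma abs_mul_conjPoissonKer_le {ε : ℝ} (hε : 0 < ε) (t : ℝ) :
    |t| * |conjPoissonKer ε t| ≤ 1 := by
  unfold conjPoissonKer
  rw [abs_div, abs_of_pos (by positivity : 0 < t ^ 2 + ε ^ 2), ← mul_div_assoc,
    div_le_iff₀ (by positivity)]
  nlinarith [sq_abs t, sq_nonneg ε]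

/-- The symmetrised product of three conjugate Poisson kernels is controlled by Poisson kernels. -/
lemma conjPoissonKer_symm_sum_le {ε : ℝ} (hε : 0 < ε) (a b c : ℝ) :
    conjPoissonKer ε (a - b) * conjPoissonKer ε (a - c)
      + conjPoissonKer ε (b - a) * conjPoissonKer ε (b - c)
      + conjPoissonKer ε (c - a) * conjPoissonKer ε (c - b)
    ≤ 1 / 2 * (poissonKer ε (a - b) * poissonKer ε (a - c)
      + poissonKer ε (b - a) * poissonKer ε (b - c)
      + poissonKer ε (c - a) * poissonKer ε (c - b)) := by
  obtain ⟨u, rfl⟩ : ∃ u, a = u + b := ⟨a - b, by ring⟩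
  obtain ⟨v, rfl⟩ : ∃ v, b = v + c := ⟨b - c, by ring⟩
  have key : 1 / 2 * (poissonKer ε u * poissonKer ε (u + v) + poissonKer ε u * poissonKer ε v
        + poissonKer ε (u + v) * poissonKer ε v)
      - (conjPoissonKer ε u * conjPoissonKer ε (u + v) - conjPoissonKer ε u * conjPoissonKer ε v
        + conjPoissonKer ε (u + v) * conjPoissonKer ε v)
      = 3 / 2 * (ε * poissonKer ε u * poissonKer ε v * poissonKer ε (u + v)) := by
    have h1 : u ^ 2 + ε ^ 2 ≠ 0 := by positivity
    have h2 : v ^ 2 + ε ^ 2 ≠ 0 := by positivity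
    have h3 : (u + v) ^ 2 + ε ^ 2 ≠ 0 := by positivity
    unfold poissonKer conjPoissonKer
    field_simp
    ring
  have hpos : 0 ≤ ε * poissonKer ε u * poissonKer ε v * poissonKer ε (u + v) := by
    have := poissonKer_nonneg hε u
    have := poissonKer_nonneg hε v
    have := poissonKer_nonneg hε (u + v)
    positivity
  rw [conjPoissonKer_sub_comm ε (v + c) (u + (v + c)), conjPoissonKer_sub_comm ε c (u + (v + c)),
    conjPoissonKer_sub_comm ε c (v + c), poissonKer_sub_comm ε (v + c) (u + (v + c)),
    poissonKer_sub_comm ε c (u + (v + c)), poissonKer_sub_comm ε c (v + c)]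
  have e1 : u + (v + c) - (v + c) = u := by ring
  have e2 : u + (v + c) - c = u + v := by ring
  have e3 : v + c - c = v := by ring
  rw [e1, e2, e3]
  linarith

/-- The difference quotient of the real part of the resolvent, with a mollified denominator. -/
lemma conjPoissonKer_sub_mul_conjPoissonKer {η ε : ℝ} (hη : 0 < η) (hε : 0 < ε) (x b c : ℝ) :
    (conjPoissonKer η (x - b) - conjPoissonKer η (x - c)) * conjPoissonKer ε (b - c)
      = (conjPoissonKer η (x - b) * conjPoissonKer η (x - c)
          - poissonKer η (x - b) * poissonKer η (x - c)) * (1 - ε * poissonKer ε (b - c)) := by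
  have h1 : (x - b) ^ 2 + η ^ 2 ≠ 0 := by positivity
  have h2 : (x - c) ^ 2 + η ^ 2 ≠ 0 := by positivity
  have h3 : (b - c) ^ 2 + ε ^ 2 ≠ 0 := by positivity
  unfold poissonKer conjPoissonKer
  field_simp
  ring

section FiniteMeasure

lemma Continuous.integrable_of_abs_le {X : Type*} [TopologicalSpace X] [MeasurableSpace X]
    [OpensMeasurableSpace X] {m : Measure X} [IsFiniteMeasure m] {f : X → ℝ}
    [SecondCountableTopology X]
    (hf : Continuous f) (C : ℝ) (hC : ∀ x, |f x| ≤ C) : Integrable f m :=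
  Integrable.of_bound hf.aestronglyMeasurable C (ae_of_all _ hC)

/-- The (unnormalised) conjugate Poisson integral of a measure on the line. -/
noncomputable def conjPoissonInt (m : Measure ℝ) (ε x : ℝ) : ℝ := ∫ y, conjPoissonKer ε (x - y) ∂m

/-- The (unnormalised) Poisson integral of a measure on the line. -/
noncomputable def poissonInt (m : Measure ℝ) (ε x : ℝ) : ℝ := ∫ y, poissonKer ε (x - y) ∂m

lemma integral_add_add {X : Type*} [MeasurableSpace X] {m : Measure X} {f g h : X → ℝ}
    (hf : Integrable f m) (hg : Integrable g m) (hh : Integrable h m) :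
    ∫ x, (f x + g x + h x) ∂m = ∫ x, f x ∂m + ∫ x, g x ∂m + ∫ x, h x ∂m := by
  rw [← integral_add hf hg]
  exact integral_add (hf.add hg) hh

variable (m : Measure ℝ) [IsFiniteMeasure m]

lemma continuous_integral_comp_sub {k : ℝ → ℝ} (hk : Continuous k) {C : ℝ}
    (hC : ∀ t, |k t| ≤ C) : Continuous fun x => ∫ y, k (x - y) ∂m :=
  continuous_of_dominated (bound := fun _ => C)
    (fun x => (by fun_prop : Continuous fun y => k (x - y)).aestronglyMeasurable)
    (fun x => ae_of_all _ fun y => hC _) (integrable_const _)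
    (ae_of_all _ fun y => by fun_prop)

lemma abs_integral_comp_sub_le {k : ℝ → ℝ} {C : ℝ}
    (hC : ∀ t, |k t| ≤ C) (x : ℝ) : |∫ y, k (x - y) ∂m| ≤ C * m.real Set.univ :=
  norm_integral_le_of_norm_le_const (μ := m) (f := fun y => k (x - y)) (ae_of_all _ fun _ => hC _)

lemma integral_prod_ker_mul_ker {k l : ℝ → ℝ} (hk : Continuous k) (hl : Continuous l)
    {C D : ℝ} (hkC : ∀ t, |k t| ≤ C) (hlD : ∀ t, |l t| ≤ D) (a : ℝ) :
    Integrable (fun q : ℝ × ℝ => k (q.1 - a) * l (q.1 - q.2)) (m.prod m) ∧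
    Integrable (fun q : ℝ × ℝ => k (q.2 - a) * l (q.2 - q.1)) (m.prod m) ∧
    ∫ q : ℝ × ℝ, k (q.1 - a) * l (q.1 - q.2) ∂(m.prod m)
      = ∫ b, k (b - a) * ∫ c, l (b - c) ∂m ∂m ∧
    ∫ q : ℝ × ℝ, k (q.2 - a) * l (q.2 - q.1) ∂(m.prod m)
      = ∫ b, k (b - a) * ∫ c, l (b - c) ∂m ∂m := by
  have hI : Integrable (fun q : ℝ × ℝ => k (q.1 - a) * l (q.1 - q.2)) (m.prod m) := by
    refine Continuous.integrable_of_abs_le (by fun_prop) (C * D) fun q => ?_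
    rw [abs_mul]
    exact mul_le_mul (hkC _) (hlD _) (abs_nonneg _) ((abs_nonneg _).trans (hkC 0))
  have hE : ∫ q : ℝ × ℝ, k (q.1 - a) * l (q.1 - q.2) ∂(m.prod m)
      = ∫ b, k (b - a) * ∫ c, l (b - c) ∂m ∂m := by
    rw [integral_prod _ hI]
    simp only [integral_const_mul]
  refine ⟨hI, hI.swap, hE, ?_⟩
  rw [← hE]
  exact integral_prod_swap (fun q : ℝ × ℝ => k (q.1 - a) * l (q.1 - q.2))

lemma integral_prod_ker_mul_ker_const {k : ℝ → ℝ} (hk : Continuous k) {C : ℝ}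
    (hkC : ∀ t, |k t| ≤ C) (a : ℝ) :
    Integrable (fun q : ℝ × ℝ => k (a - q.1) * k (a - q.2)) (m.prod m) ∧
    ∫ q : ℝ × ℝ, k (a - q.1) * k (a - q.2) ∂(m.prod m) = (∫ b, k (a - b) ∂m) ^ 2 := by
  refine ⟨Continuous.integrable_of_abs_le (by fun_prop) (C * C) fun q => ?_, ?_⟩
  · rw [abs_mul]
    exact mul_le_mul (hkC _) (hkC _) (abs_nonneg _) ((abs_nonneg _).trans (hkC 0))
  · rw [integral_prod_mul (fun b => k (a - b)) fun c => k (a - c), sq]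

variable {m}

lemma conjPoissonInt_sq_add_le {ε : ℝ} (hε : 0 < ε) {C : ℝ} (hC : ∀ x, poissonInt m ε x ≤ C)
    (a : ℝ) :
    conjPoissonInt m ε a ^ 2 + 2 * ∫ b, conjPoissonKer ε (b - a) * conjPoissonInt m ε b ∂m
      ≤ 3 / 2 * C ^ 2 := by
  have kc := continuous_conjPoissonKer hε
  have pc := continuous_poissonKer hε
  obtain ⟨i1, i2, e1, e2⟩ := integral_prod_ker_mul_ker m kc kc
    (abs_conjPoissonKer_le hε) (abs_conjPoissonKer_le hε) a
  obtain ⟨j1, j2, f1, f2⟩ := integral_prod_ker_mul_ker m pc pc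
    (abs_poissonKer_le hε) (abs_poissonKer_le hε) a
  obtain ⟨i0, e0⟩ := integral_prod_ker_mul_ker_const m kc (abs_conjPoissonKer_le hε) a
  obtain ⟨j0, f0⟩ := integral_prod_ker_mul_ker_const m pc (abs_poissonKer_le hε) a
  have h0 : ∀ x, 0 ≤ poissonInt m ε x := fun x => integral_nonneg fun y => poissonKer_nonneg hε _
  have hmono := integral_mono ((i0.add i1).add i2) (((j0.add j1).add j2).const_mul (1 / 2))
    fun q => conjPoissonKer_symm_sum_le hε a q.1 q.2
  simp only [Pi.add_apply] at hmono
  rw [integral_const_mul, integral_add_add i0 i1 i2, integral_add_add j0 j1 j2,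
    e0, e1, e2, f0, f1, f2] at hmono
  have hC0 : 0 ≤ C := (h0 0).trans (hC 0)
  have hP : ∫ b, poissonKer ε (b - a) * poissonInt m ε b ∂m ≤ C ^ 2 := by
    calc ∫ b, poissonKer ε (b - a) * poissonInt m ε b ∂m
        ≤ ∫ b, poissonKer ε (a - b) * C ∂m := by
          refine integral_mono_of_nonneg
            (ae_of_all _ fun b => mul_nonneg (poissonKer_nonneg hε _) (h0 b)) ?_
            (ae_of_all _ fun b => ?_)
          · exact (Continuous.integrable_of_abs_le (by fun_prop) ε⁻¹
              fun b => abs_poissonKer_le hε _).mul_const C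
          · simp only [poissonKer_sub_comm ε a b]
            exact mul_le_mul_of_nonneg_left (hC b) (poissonKer_nonneg hε _)
      _ = poissonInt m ε a * C := integral_mul_const _ _
      _ ≤ C ^ 2 := by rw [sq]; exact mul_le_mul_of_nonneg_right (hC a) hC0
  have hsq : poissonInt m ε a ^ 2 ≤ C ^ 2 := pow_le_pow_left₀ (h0 a) (hC a) 2
  unfold conjPoissonInt poissonInt at *
  linarith

lemma continuous_conjPoissonInt {ε : ℝ} (hε : 0 < ε) : Continuous (conjPoissonInt m ε) :=
  continuous_integral_comp_sub m (continuous_conjPoissonKer hε) (abs_conjPoissonKer_le hε)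

lemma abs_conjPoissonInt_le {ε : ℝ} (hε : 0 < ε) (x : ℝ) :
    |conjPoissonInt m ε x| ≤ ε⁻¹ * m.real Set.univ :=
  abs_integral_comp_sub_le m (abs_conjPoissonKer_le hε) x

lemma integrable_conjPoissonInt_sq {ε : ℝ} (hε : 0 < ε) :
    Integrable (fun a => conjPoissonInt m ε a ^ 2) m := by
  have hc := continuous_conjPoissonInt (m := m) hε
  refine Continuous.integrable_of_abs_le (by fun_prop) ((ε⁻¹ * m.real Set.univ) ^ 2) fun a => ?_
  rw [abs_pow]
  exact pow_le_pow_left₀ (abs_nonneg _) (abs_conjPoissonInt_le hε a) 2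

/-- `L²` boundedness of the conjugate Poisson integral with respect to the measure itself. -/
lemma integral_conjPoissonInt_sq_le {ε : ℝ} (hε : 0 < ε) {C : ℝ}
    (hC : ∀ x, poissonInt m ε x ≤ C) :
    ∫ a, conjPoissonInt m ε a ^ 2 ∂m ≤ 1 / 2 * C ^ 2 * m.real Set.univ := by
  have kc := continuous_conjPoissonKer hε
  have hc := continuous_conjPoissonInt (m := m) hε
  have hI : Integrable (fun q : ℝ × ℝ => conjPoissonKer ε (q.2 - q.1) * conjPoissonInt m ε q.2)
      (m.prod m) := by
    refine Continuous.integrable_of_abs_le (by fun_prop) (ε⁻¹ * (ε⁻¹ * m.real Set.univ))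
      fun q => ?_
    rw [abs_mul]
    exact mul_le_mul (abs_conjPoissonKer_le hε _) (abs_conjPoissonInt_le hε _) (abs_nonneg _)
      (by positivity)
  have hswap : ∫ a, ∫ b, conjPoissonKer ε (b - a) * conjPoissonInt m ε b ∂m ∂m
      = ∫ b, conjPoissonInt m ε b ^ 2 ∂m := by
    rw [integral_integral_swap (f := fun a b => conjPoissonKer ε (b - a) * conjPoissonInt m ε b) hI]
    refine integral_congr_ae (ae_of_all _ fun b => ?_)
    simp only [integral_mul_const, sq]
    rfl
  have hmono := integral_mono ((integrable_conjPoissonInt_sq (m := m) hε).add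
    (hI.integral_prod_left.const_mul 2)) (integrable_const _)
    fun a => conjPoissonInt_sq_add_le hε hC a
  simp only [Pi.add_apply] at hmono
  rw [integral_add (integrable_conjPoissonInt_sq hε) (hI.integral_prod_left.const_mul 2),
    integral_const_mul, hswap, integral_const, smul_eq_mul] at hmono
  linarith

lemma abs_sub_clip_le {N : ℝ} (hN : 0 < N) (t : ℝ) : |t - max (-N) (min t N)| ≤ t ^ 2 / N := by
  rw [le_div_iff₀ hN]
  rcases le_total t N with h1 | h1
  · rw [min_eq_left h1]
    rcases le_total (-N) t with h2 | h2
    · rw [max_eq_right h2]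
      simpa using sq_nonneg t
    · rw [max_eq_left h2, abs_of_nonpos (by linarith)]
      nlinarith
  · rw [min_eq_right h1, max_eq_right (by linarith), abs_of_nonneg (by linarith)]
    nlinarith

/-- Pointwise convergence with an `L²` bound implies convergence of integrals against a bounded
function. -/
lemma tendsto_integral_mul_of_sq_bound {X ι : Type*} [MeasurableSpace X] {m : Measure X}
    [IsFiniteMeasure m] {l : Filter ι} [l.IsCountablyGenerated] {F : ι → X → ℝ} {H f : X → ℝ}
    {A B D : ℝ} (hF : ∀ᶠ i in l, AEStronglyMeasurable (F i) m)
    (hF2 : ∀ᶠ i in l, Integrable (fun x => F i x ^ 2) m)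
    (hD : ∀ᶠ i in l, ∫ x, F i x ^ 2 ∂m ≤ D)
    (hlim : ∀ᵐ x ∂m, Tendsto (fun i => F i x) l (𝓝 (H x))) (hB : ∀ᵐ x ∂m, |H x| ≤ B)
    (hf : AEStronglyMeasurable f m) (hA : ∀ x, |f x| ≤ A) :
    Tendsto (fun i => ∫ x, f x * F i x ∂m) l (𝓝 (∫ x, f x * H x ∂m)) := by
  rcases isEmpty_or_nonempty X with hX | ⟨⟨x₀⟩⟩
  · simpa [integral_of_isEmpty] using tendsto_const_nhds
  have hA0 : 0 ≤ A := (abs_nonneg _).trans (hA x₀)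
  rw [Metric.tendsto_nhds]
  intro δ hδ
  set N : ℝ := max (max 1 B) (2 * (A * |D| + 1) / δ) with hNdef
  have hN1 : 0 < N := lt_of_lt_of_le one_pos ((le_max_left _ _).trans (le_max_left _ _))
  have hNB : B ≤ N := (le_max_right _ _).trans (le_max_left _ _)
  have hND : 2 * (A * |D| + 1) / δ ≤ N := le_max_right _ _
  have hclip : ∀ t : ℝ, |max (-N) (min t N)| ≤ N := fun t =>
    abs_le.2 ⟨le_max_left _ _, max_le (by linarith) (min_le_right _ _)⟩
  have hcc : Continuous fun t : ℝ => max (-N) (min t N) := by fun_prop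
  have hdct : Tendsto (fun i => ∫ x, f x * max (-N) (min (F i x) N) ∂m) l
      (𝓝 (∫ x, f x * H x ∂m)) := by
    refine tendsto_integral_filter_of_dominated_convergence (fun _ => A * N) ?_ ?_
      (integrable_const _) ?_
    · filter_upwards [hF] with i hi
      exact hf.mul (hcc.comp_aestronglyMeasurable hi)
    · refine Eventually.of_forall fun i => ae_of_all _ fun x => ?_
      rw [norm_mul]
      exact mul_le_mul (hA x) (hclip _) (norm_nonneg _) hA0
    · filter_upwards [hlim, hB] with x hx hxB
      have h1 := ((hcc.tendsto (H x)).comp hx).const_mul (f x)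
      have h2 := abs_le.1 hxB
      rwa [min_eq_left (h2.2.trans hNB), max_eq_right (by linarith)] at h1
  filter_upwards [Metric.tendsto_nhds.1 hdct (δ / 2) (half_pos hδ), hF, hF2, hD]
    with i hi hFi hF2i hDi
  have hIF : Integrable (F i) m := by
    refine ((hF2i.add (integrable_const 1))).mono' hFi (ae_of_all _ fun x => ?_)
    simp only [Pi.add_apply, Real.norm_eq_abs]
    nlinarith [sq_abs (F i x), sq_nonneg (|F i x| - 1)]
  have hI1 : Integrable (fun x => f x * F i x) m := hIF.bdd_mul hf (ae_of_all _ hA)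
  have hI2 : Integrable (fun x => f x * max (-N) (min (F i x) N)) m :=
    (Integrable.of_bound (hcc.comp_aestronglyMeasurable hFi) N
      (ae_of_all _ fun x => hclip _)).bdd_mul hf (ae_of_all _ hA)
  have hdiff : |∫ x, f x * F i x ∂m - ∫ x, f x * max (-N) (min (F i x) N) ∂m| ≤ A * (D / N) := by
    rw [← integral_sub hI1 hI2]
    calc |∫ x, (f x * F i x - f x * max (-N) (min (F i x) N)) ∂m|
        ≤ ∫ x, A * (F i x ^ 2 / N) ∂m := by
          refine norm_integral_le_of_norm_le (f := fun x => f x * F i x - _)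
            ((hF2i.div_const N).const_mul A) (ae_of_all _ fun x => ?_)
          rw [← mul_sub, norm_mul]
          exact mul_le_mul (hA x) (abs_sub_clip_le hN1 _) (norm_nonneg _) hA0
      _ ≤ A * (D / N) := by
          rw [integral_const_mul, integral_div]
          gcongr
  have hsmall : A * (D / N) < δ / 2 := by
    rw [div_le_iff₀ hδ] at hND
    rw [← mul_div_assoc, div_lt_iff₀ hN1]
    nlinarith [mul_le_mul_of_nonneg_left (le_abs_self D) hA0]
  rw [Real.dist_eq] at hi ⊢
  have := abs_sub_le (∫ x, f x * F i x ∂m) (∫ x, f x * max (-N) (min (F i x) N) ∂m)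
    (∫ x, f x * H x ∂m)
  linarith

lemma abs_conjPoissonInt_sq_sub_le {η ε : ℝ} (hη : 0 < η) (hε : 0 < ε) {C : ℝ}
    (hC : ∀ x, poissonInt m ε x ≤ C) (x : ℝ) :
    |conjPoissonInt m η x ^ 2 - poissonInt m η x ^ 2
      - 2 * ∫ b, conjPoissonKer η (x - b) * conjPoissonInt m ε b ∂m|
      ≤ ε * (2 * (η⁻¹ * η⁻¹) * (C * m.real Set.univ)) := by
  have kη := continuous_conjPoissonKer hη
  have pη := continuous_poissonKer hη
  have kε := continuous_conjPoissonKer hε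
  have pε := continuous_poissonKer hε
  obtain ⟨i1, i2, e1, e2⟩ := integral_prod_ker_mul_ker m kη kε
    (abs_conjPoissonKer_le hη) (abs_conjPoissonKer_le hε) x
  obtain ⟨i0, e0⟩ := integral_prod_ker_mul_ker_const m kη (abs_conjPoissonKer_le hη) x
  obtain ⟨j0, f0⟩ := integral_prod_ker_mul_ker_const m pη (abs_poissonKer_le hη) x
  have hPI : Integrable (fun q : ℝ × ℝ => poissonKer ε (q.1 - q.2)) (m.prod m) :=
    Continuous.integrable_of_abs_le (by fun_prop) ε⁻¹ fun q => abs_poissonKer_le hε _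
  have hPle : ∫ q : ℝ × ℝ, poissonKer ε (q.1 - q.2) ∂(m.prod m) ≤ C * m.real Set.univ := by
    rw [integral_prod _ hPI]
    have := integral_mono hPI.integral_prod_left (integrable_const C) fun a => hC a
    simpa [mul_comm] using this
  have hx : ∀ b, conjPoissonKer η (x - b) = -conjPoissonKer η (b - x) :=
    fun b => conjPoissonKer_sub_comm η x b
  have hsum : conjPoissonInt m η x ^ 2 - poissonInt m η x ^ 2
      - 2 * ∫ b, conjPoissonKer η (x - b) * conjPoissonInt m ε b ∂m
      = ∫ q : ℝ × ℝ, (conjPoissonKer η (x - q.1) * conjPoissonKer η (x - q.2)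
          - poissonKer η (x - q.1) * poissonKer η (x - q.2))
          * (ε * poissonKer ε (q.1 - q.2)) ∂(m.prod m) := by
    have hpt : ∀ q : ℝ × ℝ, (conjPoissonKer η (x - q.1) * conjPoissonKer η (x - q.2)
          - poissonKer η (x - q.1) * poissonKer η (x - q.2)) * (ε * poissonKer ε (q.1 - q.2))
        = (conjPoissonKer η (x - q.1) * conjPoissonKer η (x - q.2)
          - poissonKer η (x - q.1) * poissonKer η (x - q.2))
          + conjPoissonKer η (q.1 - x) * conjPoissonKer ε (q.1 - q.2)
          + conjPoissonKer η (q.2 - x) * conjPoissonKer ε (q.2 - q.1) := fun q => by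
      have := conjPoissonKer_sub_mul_conjPoissonKer hη hε x q.1 q.2
      rw [conjPoissonKer_sub_comm ε q.2 q.1]
      rw [sub_mul, hx q.1, hx q.2] at this
      rw [hx q.1, hx q.2]
      linear_combination this
    have hij : Integrable (fun q : ℝ × ℝ => conjPoissonKer η (x - q.1) * conjPoissonKer η (x - q.2)
          - poissonKer η (x - q.1) * poissonKer η (x - q.2)) (m.prod m) := i0.sub j0
    simp only [hpt]
    rw [integral_add_add hij i1 i2, integral_sub i0 j0, e0, f0, e1, e2]
    simp only [hx, neg_mul, integral_neg]
    unfold conjPoissonInt poissonInt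
    simp only [hx, integral_neg]
    ring
  rw [hsum, ← Real.norm_eq_abs]
  calc ‖_‖ ≤ ∫ q : ℝ × ℝ, 2 * (η⁻¹ * η⁻¹) * (ε * poissonKer ε (q.1 - q.2)) ∂(m.prod m) := by
        refine norm_integral_le_of_norm_le ((hPI.const_mul ε).const_mul _)
          (ae_of_all _ fun q => ?_)
        rw [norm_mul, Real.norm_eq_abs (ε * _),
          abs_of_nonneg (mul_nonneg hε.le (poissonKer_nonneg hε _))]
        refine mul_le_mul_of_nonneg_right ?_ (mul_nonneg hε.le (poissonKer_nonneg hε _))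
        refine (norm_sub_le _ _).trans ?_
        rw [norm_mul, norm_mul, two_mul]
        exact add_le_add
          (mul_le_mul (abs_conjPoissonKer_le hη _) (abs_conjPoissonKer_le hη _)
            (abs_nonneg _) (by positivity))
          (mul_le_mul (abs_poissonKer_le hη _) (abs_poissonKer_le hη _)
            (abs_nonneg _) (by positivity))
    _ ≤ ε * (2 * (η⁻¹ * η⁻¹) * (C * m.real Set.univ)) := by
        rw [integral_const_mul, integral_const_mul]
        calc _ = ε * (2 * (η⁻¹ * η⁻¹)
              * ∫ q : ℝ × ℝ, poissonKer ε (q.1 - q.2) ∂(m.prod m)) := by ring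
          _ ≤ _ := by gcongr

/-- The quadratic loop equation (real part, off the real axis) for a finite measure on the line
whose Poisson integrals are bounded. -/
lemma conjPoissonInt_sq_sub_poissonInt_sq {C B : ℝ} {H : ℝ → ℝ}
    (hC : ∀ ε > 0, ∀ x, poissonInt m ε x ≤ C)
    (hlim : ∀ᵐ x ∂m, Tendsto (fun ε => conjPoissonInt m ε x) (𝓝[>] 0) (𝓝 (H x)))
    (hB : ∀ᵐ x ∂m, |H x| ≤ B) {η : ℝ} (hη : 0 < η) (x : ℝ) :
    conjPoissonInt m η x ^ 2 - poissonInt m η x ^ 2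
      = 2 * ∫ b, conjPoissonKer η (x - b) * H b ∂m := by
  have kη := continuous_conjPoissonKer hη
  have hpos : ∀ᶠ ε : ℝ in 𝓝[>] 0, 0 < ε := self_mem_nhdsWithin
  have h1 : Tendsto (fun ε => ∫ b, conjPoissonKer η (x - b) * conjPoissonInt m ε b ∂m) (𝓝[>] 0)
      (𝓝 (∫ b, conjPoissonKer η (x - b) * H b ∂m)) := by
    refine tendsto_integral_mul_of_sq_bound (A := η⁻¹) (D := 1 / 2 * C ^ 2 * m.real Set.univ)
      ?_ ?_ ?_ hlim hB
      (by fun_prop : Continuous fun b => conjPoissonKer η (x - b)).aestronglyMeasurable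
      fun b => abs_conjPoissonKer_le hη _
    · filter_upwards [hpos] with ε hε
      exact (continuous_conjPoissonInt hε).aestronglyMeasurable
    · filter_upwards [hpos] with ε hε
      exact integrable_conjPoissonInt_sq hε
    · filter_upwards [hpos] with ε hε
      exact integral_conjPoissonInt_sq_le hε (hC ε hε)
  have h2 := ((h1.const_mul 2).const_sub (conjPoissonInt m η x ^ 2 - poissonInt m η x ^ 2)).abs
  have h3 : Tendsto (fun ε : ℝ => ε * (2 * (η⁻¹ * η⁻¹) * (C * m.real Set.univ))) (𝓝[>] 0)
      (𝓝 0) := by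
    have : Tendsto (fun ε : ℝ => ε * (2 * (η⁻¹ * η⁻¹) * (C * m.real Set.univ))) (𝓝 0)
        (𝓝 (0 * (2 * (η⁻¹ * η⁻¹) * (C * m.real Set.univ)))) := tendsto_id.mul_const _
    rw [zero_mul] at this
    exact this.mono_left nhdsWithin_le_nhds
  have h4 := le_of_tendsto_of_tendsto h2 h3 (by
    filter_upwards [hpos] with ε hε
    exact abs_conjPoissonInt_sq_sub_le hη hε (hC ε hε) x)
  exact sub_eq_zero.1 (abs_nonpos_iff.1 h4)

end FiniteMeasure

section Density

lemma integral_mul_dilation (r k : ℝ → ℝ) {η : ℝ} (hη : 0 < η) (x : ℝ) :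
    ∫ y, r y * (η⁻¹ * k ((x - y) / η)) = ∫ t, r (x - η * t) * k t := by
  have h1 := integral_sub_left_eq_self (fun s => r (x - s) * (η⁻¹ * k (s / η))) volume x
  simp only [sub_sub_cancel] at h1
  have h2 := Measure.integral_comp_mul_left (fun s => r (x - s) * k (s / η)) η
  simp only [mul_div_cancel_left₀ _ hη.ne'] at h2
  rw [h1, h2, abs_of_pos (inv_pos.2 hη), smul_eq_mul, ← integral_const_mul]
  exact integral_congr_ae (ae_of_all _ fun s => by ring)

lemma tendsto_integral_dilation {r k : ℝ → ℝ} (hr : Continuous r) {M : ℝ} (hM : ∀ y, |r y| ≤ M)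
    (hk : Measurable k) (hk1 : ∀ t, |k t| ≤ (1 + t ^ 2)⁻¹) (x : ℝ) :
    Tendsto (fun η => ∫ y, r y * (η⁻¹ * k ((x - y) / η))) (𝓝[>] 0) (𝓝 (r x * ∫ t, k t)) := by
  have h : Tendsto (fun η : ℝ => ∫ t, r (x - η * t) * k t) (𝓝[>] 0) (𝓝 (∫ t, r x * k t)) := by
    refine tendsto_integral_filter_of_dominated_convergence (fun t => M * (1 + t ^ 2)⁻¹) ?_ ?_
      (integrable_inv_one_add_sq.const_mul M) ?_
    · refine Eventually.of_forall fun η => ?_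
      exact ((by fun_prop : Continuous fun t => r (x - η * t)).measurable.mul
        hk).aestronglyMeasurable
    · refine Eventually.of_forall fun η => ae_of_all _ fun t => ?_
      rw [norm_mul]
      exact mul_le_mul (hM _) (hk1 t) (norm_nonneg _) ((abs_nonneg _).trans (hM 0))
    · refine ae_of_all _ fun t => ?_
      have hc : Continuous fun η : ℝ => r (x - η * t) * k t := by fun_prop
      have := hc.tendsto 0
      simp only [zero_mul, sub_zero] at this
      exact this.mono_left nhdsWithin_le_nhds
  rw [← integral_const_mul]
  refine h.congr' ?_
  filter_upwards [self_mem_nhdsWithin] with η hη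
  exact (integral_mul_dilation r k hη x).symm

/-- The difference between the conjugate Poisson kernel and the truncated Hilbert kernel. -/
noncomputable def conjPoissonTruncDiff (t : ℝ) : ℝ := t / (1 + t ^ 2) - if |t| < 1 then 0 else t⁻¹

lemma measurable_conjPoissonTruncDiff : Measurable conjPoissonTruncDiff := by
  unfold conjPoissonTruncDiff
  refine Measurable.sub (by fun_prop) (Measurable.ite ?_ measurable_const measurable_inv)
  exact measurableSet_lt (by fun_prop) measurable_const

lemma abs_conjPoissonTruncDiff_le (t : ℝ) : |conjPoissonTruncDiff t| ≤ (1 + t ^ 2)⁻¹ := by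
  unfold conjPoissonTruncDiff
  have hp : 0 < 1 + t ^ 2 := by positivity
  split_ifs with h
  · rw [sub_zero, abs_div, abs_of_pos hp, div_eq_mul_inv]
    exact mul_le_of_le_one_left (by positivity) h.le
  · have h1 : 1 ≤ |t| := not_lt.1 h
    have ht : t ≠ 0 := abs_pos.1 (by linarith)
    have e : t / (1 + t ^ 2) - t⁻¹ = -(t⁻¹ * (1 + t ^ 2)⁻¹) := by
      field_simp
      ring
    rw [e, abs_neg, abs_mul, abs_inv, abs_inv, abs_of_pos hp]
    exact mul_le_of_le_one_left (by positivity) (inv_le_one_of_one_le₀ h1)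

lemma integral_conjPoissonTruncDiff : ∫ t, conjPoissonTruncDiff t = 0 := by
  have hodd : ∀ t, conjPoissonTruncDiff (-t) = -conjPoissonTruncDiff t := fun t => by
    unfold conjPoissonTruncDiff
    simp only [abs_neg, neg_sq, inv_neg, neg_div]
    split_ifs <;> ring
  have h := integral_neg_eq_self conjPoissonTruncDiff volume
  simp only [hodd, integral_neg] at h
  linarith

lemma conjPoissonKer_sub_trunc {η : ℝ} (hη : 0 < η) (s : ℝ) :
    conjPoissonKer η s - (if |s| < η then 0 else s⁻¹) = η⁻¹ * conjPoissonTruncDiff (s / η) := by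
  unfold conjPoissonKer conjPoissonTruncDiff
  have e : |s / η| < 1 ↔ |s| < η := by rw [abs_div, abs_of_pos hη, div_lt_one hη]
  have e1 : s / (s ^ 2 + η ^ 2) = η⁻¹ * (s / η / (1 + (s / η) ^ 2)) := by
    field_simp
    ring
  simp only [e, mul_sub, e1]
  split_ifs
  · simp
  · field_simp

lemma poissonKer_eq_dilation {η : ℝ} (hη : 0 < η) (s : ℝ) :
    poissonKer η s = η⁻¹ * (1 + (s / η) ^ 2)⁻¹ := by
  unfold poissonKer
  field_simp
  ring

lemma integral_withDensity_ofReal {r : ℝ → ℝ} (hr : Continuous r) (hr0 : ∀ y, 0 ≤ r y)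
    (f : ℝ → ℝ) :
    ∫ y, f y ∂(volume.withDensity fun y => ENNReal.ofReal (r y)) = ∫ y, r y * f y := by
  rw [integral_withDensity_eq_integral_toReal_smul (by fun_prop) (by simp)]
  simp only [ENNReal.toReal_ofReal (hr0 _), smul_eq_mul]

lemma poissonInt_withDensity {r : ℝ → ℝ} (hr : Continuous r) (hr0 : ∀ y, 0 ≤ r y) {η : ℝ}
    (hη : 0 < η) (x : ℝ) :
    poissonInt (volume.withDensity fun y => ENNReal.ofReal (r y)) η x
      = ∫ y, r y * (η⁻¹ * (1 + ((x - y) / η) ^ 2)⁻¹) := by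
  unfold poissonInt
  rw [integral_withDensity_ofReal hr hr0]
  simp only [poissonKer_eq_dilation hη]

lemma poissonInt_withDensity_le {r : ℝ → ℝ} (hr : Continuous r) (hr0 : ∀ y, 0 ≤ r y) {M : ℝ}
    (hM : ∀ y, |r y| ≤ M) {η : ℝ} (hη : 0 < η) (x : ℝ) :
    poissonInt (volume.withDensity fun y => ENNReal.ofReal (r y)) η x ≤ M * Real.pi := by
  rw [poissonInt_withDensity hr hr0 hη,
    integral_mul_dilation r (fun t => (1 + t ^ 2)⁻¹) hη, ← integral_univ_inv_one_add_sq,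
    ← integral_const_mul]
  refine integral_mono_of_nonneg (ae_of_all _ fun t => ?_)
    (integrable_inv_one_add_sq.const_mul M) (ae_of_all _ fun t => ?_)
  · exact mul_nonneg (hr0 _) (by positivity)
  · exact mul_le_mul_of_nonneg_right ((le_abs_self _).trans (hM _)) (by positivity)

lemma tendsto_poissonInt_withDensity {r : ℝ → ℝ} (hr : Continuous r) (hr0 : ∀ y, 0 ≤ r y) {M : ℝ}
    (hM : ∀ y, |r y| ≤ M) (x : ℝ) :
    Tendsto (fun η => poissonInt (volume.withDensity fun y => ENNReal.ofReal (r y)) η x)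
      (𝓝[>] 0) (𝓝 (r x * Real.pi)) := by
  have h := tendsto_integral_dilation (k := fun t => (1 + t ^ 2)⁻¹) hr hM (by fun_prop)
    (fun t => (abs_of_nonneg (by positivity)).le) x
  rw [integral_univ_inv_one_add_sq] at h
  refine h.congr' ?_
  filter_upwards [self_mem_nhdsWithin] with η hη
  exact (poissonInt_withDensity hr hr0 hη x).symm

lemma integrable_mul_of_abs_le {r k : ℝ → ℝ} (hr : Integrable r) (hk : Measurable k) {C : ℝ}
    (hC : ∀ y, |k y| ≤ C) : Integrable fun y => r y * k y :=
  hr.mul_bdd hk.aestronglyMeasurable (ae_of_all _ hC)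

/-- Existence of the principal value implies convergence of conjugate Poisson integrals. -/
lemma tendsto_conjPoissonInt_withDensity {r : ℝ → ℝ} (hr : Continuous r) (hr0 : ∀ y, 0 ≤ r y)
    {M : ℝ} (hM : ∀ y, |r y| ≤ M) (hI : Integrable r) {x L : ℝ}
    (hL : Tendsto (fun η => ∫ y, r y * (if |x - y| < η then 0 else (x - y)⁻¹)) (𝓝[>] 0) (𝓝 L)) :
    Tendsto (fun η => conjPoissonInt (volume.withDensity fun y => ENNReal.ofReal (r y)) η x)
      (𝓝[>] 0) (𝓝 L) := by
  have h := tendsto_integral_dilation hr hM measurable_conjPoissonTruncDiff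
    abs_conjPoissonTruncDiff_le x
  rw [integral_conjPoissonTruncDiff, mul_zero] at h
  have h2 := h.add hL
  rw [zero_add] at h2
  refine h2.congr' ?_
  filter_upwards [self_mem_nhdsWithin] with η (hη : 0 < η)
  have hc := continuous_conjPoissonKer hη
  have i1 : Integrable fun y => r y * conjPoissonKer η (x - y) :=
    integrable_mul_of_abs_le hI (by fun_prop : Continuous fun y => _).measurable
      fun y => abs_conjPoissonKer_le hη _
  have i2 : Integrable fun y => r y * (if |x - y| < η then 0 else (x - y)⁻¹) := by
    refine integrable_mul_of_abs_le (C := η⁻¹) hI ?_ fun y => ?_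
    · exact Measurable.ite (measurableSet_lt (by fun_prop) measurable_const) measurable_const
        (by fun_prop)
    · split_ifs with hy
      · simpa using hη.le
      · rw [abs_inv]
        exact inv_anti₀ hη (not_lt.1 hy)
  unfold conjPoissonInt
  rw [integral_withDensity_ofReal hr hr0]
  simp only [← conjPoissonKer_sub_trunc hη, mul_sub]
  rw [integral_sub i1 i2]
  ring

lemma tendsto_mul_conjPoissonKer (c t : ℝ) :
    Tendsto (fun η => c * conjPoissonKer η t) (𝓝[>] 0) (𝓝 (c / t)) := by
  rcases eq_or_ne t 0 with rfl | ht
  · simp [conjPoissonKer]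
  · have hc : ContinuousAt (fun η => c * conjPoissonKer η t) 0 := by
      unfold conjPoissonKer
      exact continuousAt_const.mul (continuousAt_const.div (by fun_prop) (by positivity))
    have e : c * conjPoissonKer 0 t = c / t := by
      unfold conjPoissonKer
      field_simp
      simp
    rw [← e]
    exact hc.tendsto.mono_left nhdsWithin_le_nhds

end Density

/-- Real part of the quadratic loop equation on the support, for a continuous density whose
principal value integral is half of a function `W` that is Lipschitz on the support. -/
lemma integral_slope_mul_eq_of_principalValue {r W : ℝ → ℝ} {s : Set ℝ} (hr : Continuous r)
    (hr0 : ∀ y, 0 ≤ r y) {M : ℝ} (hM : ∀ y, |r y| ≤ M) (hI : Integrable r)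
    (hsupp : ∀ y ∉ s, r y = 0) {B : ℝ} (hB : ∀ y ∈ s, |W y| ≤ B) (hW : Measurable W) {L : NNReal}
    (hLip : LipschitzOnWith L W s)
    (hpv : ∀ x ∈ s, Tendsto (fun η => ∫ y, r y * (if |x - y| < η then 0 else (x - y)⁻¹))
      (𝓝[>] 0) (𝓝 (W x / 2))) {x : ℝ} (hx : x ∈ s) :
    ∫ y, r y * ((W x - W y) / (x - y)) = W x ^ 2 / 4 + (r x * Real.pi) ^ 2 := by
  set m : Measure ℝ := volume.withDensity fun y => ENNReal.ofReal (r y) with hm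
  have : IsFiniteMeasure m := isFiniteMeasure_withDensity_ofReal hI.hasFiniteIntegral
  have hae : ∀ᵐ y ∂m, y ∈ s := by
    rw [hm, ae_withDensity_iff (by fun_prop)]
    refine ae_of_all _ fun y hy => ?_
    by_contra h
    simp [hsupp y h] at hy
  have hlim : ∀ y ∈ s, Tendsto (fun η => conjPoissonInt m η y) (𝓝[>] 0) (𝓝 (W y / 2)) :=
    fun y hy => tendsto_conjPoissonInt_withDensity hr hr0 hM hI (hpv y hy)
  have hloop : ∀ η > 0, conjPoissonInt m η x ^ 2 - poissonInt m η x ^ 2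
      = W x * conjPoissonInt m η x - ∫ y, (W x - W y) * conjPoissonKer η (x - y) ∂m := by
    intro η hη
    have hc := continuous_conjPoissonKer hη
    rw [conjPoissonInt_sq_sub_poissonInt_sq (H := fun y => W y / 2) (B := B / 2)
      (fun ε hε y => poissonInt_withDensity_le hr hr0 hM hε y)
      (hae.mono hlim) (hae.mono fun y hy => ?_) hη x]
    · have i1 : Integrable (fun y => conjPoissonKer η (x - y)) m :=
        Continuous.integrable_of_abs_le (by fun_prop) _ fun y => abs_conjPoissonKer_le hη _
      have i2 : Integrable (fun y => W y * conjPoissonKer η (x - y)) m :=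
        i1.bdd_mul hW.aestronglyMeasurable (hae.mono hB)
      simp only [sub_mul]
      rw [integral_sub (i1.const_mul _) i2, integral_const_mul, ← integral_const_mul 2]
      unfold conjPoissonInt
      rw [sub_sub_cancel]
      exact integral_congr_ae (ae_of_all _ fun y => by ring)
    · rw [abs_div, abs_two]
      linarith [hB y hy]
  have hQ : Tendsto (fun η => ∫ y, (W x - W y) * conjPoissonKer η (x - y) ∂m) (𝓝[>] 0)
      (𝓝 (∫ y, (W x - W y) / (x - y) ∂m)) := by
    refine tendsto_integral_filter_of_dominated_convergence (fun _ => (L : ℝ)) ?_ ?_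
      (integrable_const _) (ae_of_all _ fun y => tendsto_mul_conjPoissonKer _ _)
    · filter_upwards [self_mem_nhdsWithin] with η hη
      have hc := continuous_conjPoissonKer hη
      exact ((measurable_const.sub hW).mul
        (by fun_prop : Continuous fun y => conjPoissonKer η (x - y)).measurable).aestronglyMeasurable
    · filter_upwards [self_mem_nhdsWithin] with η hη
      filter_upwards [hae] with y hy
      have h1 := hLip.norm_sub_le hx hy
      rw [norm_mul]
      calc ‖W x - W y‖ * ‖conjPoissonKer η (x - y)‖
          ≤ L * ‖x - y‖ * ‖conjPoissonKer η (x - y)‖ := by gcongr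
        _ = L * (|x - y| * |conjPoissonKer η (x - y)|) := mul_assoc _ _ _
        _ ≤ L * 1 := by gcongr; exact abs_mul_conjPoissonKer_le hη _
        _ = L := mul_one _
  have hl := ((hlim x hx).pow 2).sub ((tendsto_poissonInt_withDensity hr hr0 hM x).pow 2)
  have hrr := ((hlim x hx).const_mul (W x)).sub hQ
  have heq := tendsto_nhds_unique (hl.congr' (by
    filter_upwards [self_mem_nhdsWithin] with η hη
    exact hloop η hη)) hrr
  rw [hm, integral_withDensity_ofReal hr hr0] at heq
  linear_combination heq


open Real MeasureTheory in
/-- For a one-cut matrix model on `[-2,2]` with density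
`ρ(λ) = (1/2π) λ² P₀(λ) √(4-λ²)` satisfying the equilibrium equation
`V'(λ) = 2 p.v.∫ ρ(μ)/(λ-μ) dμ`, the function
`Q(λ) = ∫ (V'(λ)-V'(μ))/(λ-μ) ρ(μ) dμ` satisfies
`Q(λ) = (1/4)([V'(λ)]² + λ⁴ P₀(λ)² (4-λ²))` on `[-2,2]`. -/
theorem stmt_13 (V P₀ : ℝ → ℝ) (hV : ContDiff ℝ (⊤ : ℕ∞) V) (hVeven : ∀ x, V (-x) = V x)
    (hP₀cont : ContinuousOn P₀ (Set.Icc (-2 : ℝ) 2))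
    (hP₀pos : ∀ lam ∈ Set.Icc (-2 : ℝ) 2, 0 < P₀ lam)
    (ρ : ℝ → ℝ)
    (hρ : ∀ lam, ρ lam = (1 / (2 * π)) * lam ^ 2 * P₀ lam * Real.sqrt (4 - lam ^ 2))
    (heq : ∀ lam ∈ Set.Icc (-2 : ℝ) 2,
      Filter.Tendsto
        (fun ε : ℝ => 2 * ∫ μ in Set.Ioo (-2 : ℝ) 2 \ Set.Ioo (lam - ε) (lam + ε),
          ρ μ / (lam - μ))
        (nhdsWithin 0 (Set.Ioi 0)) (nhds (deriv V lam))) :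
    ∀ lam ∈ Set.Icc (-2 : ℝ) 2,
      (∫ μ in Set.Ioo (-2 : ℝ) 2, (deriv V lam - deriv V μ) / (lam - μ) * ρ μ) =
        (1 / 4) * ((deriv V lam) ^ 2 + lam ^ 4 * (P₀ lam) ^ 2 * (4 - lam ^ 2)) := by
  have hcov : ∀ y ∉ Set.Ioo (-2 : ℝ) 2, ρ y = 0 := fun y hy => by
    have hy2 : 4 - y ^ 2 ≤ 0 := by
      by_contra h
      exact hy ⟨by nlinarith, by nlinarith⟩
    rw [hρ, Real.sqrt_eq_zero_of_nonpos hy2, mul_zero]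
  have hicc : ∀ y ∉ Set.Icc (-2 : ℝ) 2, ρ y = 0 := fun y hy =>
    hcov y fun h => hy (Set.Ioo_subset_Icc_self h)
  have hr0 : ∀ y, 0 ≤ ρ y := fun y => by
    by_cases hy : y ∈ Set.Icc (-2 : ℝ) 2
    · rw [hρ]
      have := hP₀pos y hy
      positivity
    · exact (hicc y hy).ge
  have hr : Continuous ρ := by
    have hE : Continuous (Set.IccExtend (by norm_num : (-2 : ℝ) ≤ 2)
        ((Set.Icc (-2) 2).domRestrict P₀)) :=
      hP₀cont.domRestrict.Icc_extend'
    have e : ρ = fun y => (1 / (2 * π)) * y ^ 2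
        * Set.IccExtend (by norm_num : (-2 : ℝ) ≤ 2) ((Set.Icc (-2) 2).domRestrict P₀) y
        * Real.sqrt (4 - y ^ 2) := by
      funext y
      by_cases hy : y ∈ Set.Icc (-2 : ℝ) 2
      · rw [hρ, Set.IccExtend_of_mem _ _ hy]
        rfl
      · have hy2 : 4 - y ^ 2 ≤ 0 := by
          by_contra h
          exact hy ⟨by nlinarith, by nlinarith⟩
        rw [hicc y hy, Real.sqrt_eq_zero_of_nonpos hy2, mul_zero]
    rw [e]
    fun_prop
  have hcs : HasCompactSupport ρ := HasCompactSupport.intro isCompact_Icc hicc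
  obtain ⟨M, hM⟩ := hcs.exists_bound_of_continuous hr
  have hI : Integrable ρ := hr.integrable_of_hasCompactSupport hcs
  have hV1 : ContDiff ℝ 1 (deriv V) :=
    (contDiff_infty_iff_deriv.1 hV).2.of_le (by exact_mod_cast le_top)
  have hWc := hV1.continuous
  obtain ⟨B, hB⟩ := isCompact_Icc.exists_bound_of_continuousOn
    (hWc.continuousOn (s := Set.Icc (-2 : ℝ) 2))
  obtain ⟨L, hL⟩ := hV1.contDiffOn.exists_lipschitzOnWith one_ne_zero (convex_Icc (-2 : ℝ) 2)
    isCompact_Icc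
  have hpv : ∀ x ∈ Set.Icc (-2 : ℝ) 2,
      Filter.Tendsto (fun η => ∫ y, ρ y * (if |x - y| < η then 0 else (x - y)⁻¹))
        (nhdsWithin 0 (Set.Ioi 0)) (nhds (deriv V x / 2)) := by
    intro x hx
    refine ((heq x hx).div_const 2).congr fun ε => ?_
    rw [mul_div_cancel_left₀ _ two_ne_zero,
      ← integral_indicator (measurableSet_Ioo.diff measurableSet_Ioo)]
    refine integral_congr_ae (ae_of_all _ fun y => ?_)
    have habs : |x - y| < ε ↔ y ∈ Set.Ioo (x - ε) (x + ε) := by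
      rw [abs_lt, Set.mem_Ioo]
      constructor <;> rintro ⟨h1, h2⟩ <;> constructor <;> linarith
    by_cases hy : y ∈ Set.Ioo (-2 : ℝ) 2
    · by_cases hy' : y ∈ Set.Ioo (x - ε) (x + ε)
      · simp [Set.indicator, habs, hy']
      · simp only [Set.indicator, Set.mem_sdiff, habs, hy, hy', not_false_eq_true, and_self, if_true,
          if_false, div_eq_mul_inv]
    · simp [Set.indicator, hy, hcov y hy]
  intro lam hlam
  have hmain := integral_slope_mul_eq_of_principalValue hr hr0 hM hI hicc hB hWc.measurable hL hpv
    hlam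
  have hsq : Real.sqrt (4 - lam ^ 2) ^ 2 = 4 - lam ^ 2 :=
    Real.sq_sqrt (by nlinarith [hlam.1, hlam.2])
  have hint : ∫ μ in Set.Ioo (-2 : ℝ) 2, (deriv V lam - deriv V μ) / (lam - μ) * ρ μ
      = ∫ y, ρ y * ((deriv V lam - deriv V y) / (lam - y)) := by
    simp only [mul_comm (ρ _)]
    exact setIntegral_eq_integral_of_forall_compl_eq_zero fun y hy => by rw [hcov y hy, mul_zero]
  rw [hint, hmain, hρ lam]
  have hpi := Real.pi_ne_zero
  field_simp
  rw [hsq]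
  ring
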